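/- Fix a real Hilbert space V, an integer s ≥ 1 and real coefficients α_0, …, α_s with α_0 = α_1 = 1. Assume the energy identity: there are an integer k* with 2 ≤ k* ≤ s, reals β_{k*}, …, β_s, and symmetric reals (γ_{i,j})_{0≤i,j≤s−1} such that for every semi-negative continuous linear operator Z on V and every u0 ∈ V, ‖R(Z)u0‖² − ‖u0‖² = Σ_{k=k*}^s β_k ‖Z^k u0‖² + Σ_{i,j=0}^{s−1} γ_{i,j} [Z^i u0, Z^j u0]. Suppose μ₀ ∈ ℝ is such that for every μ' > μ₀ the k*×k* matrix Γ* − diag(0, …, 0, μ') is negative definite, where Γ* := (γ_{i,j})_{0≤i,j≤k*−1}, and let μ > μ₀ and ν < −β_{k*}/2. Then the filtering method with dispersive-diffusive superviscosity is strongly stable: there exists λ₀ > 0 such that for every semi-negative continuous linear operator Z on V with ‖Z‖ ≤ λ₀ and every u0 ∈ V, ‖u_F‖ ≤ ‖u0‖, where u_F := (I + μ(Z†)^{k*−1}Z^{k*} + ν(Z†)^{k*}Z^{k*}) R(Z) u0. -/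

import Mathlib

open RealInnerProductSpace ContinuousLinearMap

/-- The semi-inner-product `[v, w] := −⟨Zv, w⟩ − ⟨v, Zw⟩` associated with `Z`. -/
noncomputable def semiIP {V : Type*} [NormedAddCommGroup V] [InnerProductSpace ℝ V]
    (Z : V →L[ℝ] V) (v w : V) : ℝ :=
  -⟪Z v, w⟫ - ⟪v, Z w⟫

section Matrix

open scoped MatrixOrder

lemma Matrix.PosDef.exists_pos_sub_smul_one_posSemidef {n : Type*} [Fintype n] [DecidableEq n]
    {M : Matrix n n ℝ} (hM : M.PosDef) :
    ∃ ε : ℝ, 0 < ε ∧ (M - ε • (1 : Matrix n n ℝ)).PosSemidef := by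
  cases isEmpty_or_nonempty n
  · exact ⟨1, one_pos, by rw [Subsingleton.elim (M - _) 0]; exact .zero⟩
  · obtain ⟨ε, hε, h⟩ := (CFC.exists_pos_algebraMap_le_iff hM.isHermitian.isSelfAdjoint).2
      fun x hx ↦ hM.isStrictlyPositive.spectrum_pos hx
    refine ⟨ε, hε, ?_⟩
    rwa [Matrix.le_iff, Algebra.algebraMap_eq_smul_one] at h

end Matrix

section SemiInnerProduct

variable {V : Type*} [NormedAddCommGroup V] [InnerProductSpace ℝ V] {Z : V →L[ℝ] V}

lemma semiIP_comm (Z : V →L[ℝ] V) (v w : V) : semiIP Z v w = semiIP Z w v := by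
  simp only [semiIP, real_inner_comm]; ring

lemma semiIP_add_right (Z : V →L[ℝ] V) (v w x : V) :
    semiIP Z v (w + x) = semiIP Z v w + semiIP Z v x := by
  simp only [semiIP, inner_add_right, map_add]; ring

lemma semiIP_smul_right (Z : V →L[ℝ] V) (c : ℝ) (v w : V) :
    semiIP Z v (c • w) = c * semiIP Z v w := by
  simp only [semiIP, inner_smul_right, map_smul]; ring

lemma semiIP_sum_right {ι : Type*} (Z : V →L[ℝ] V) (t : Finset ι) (v : V) (w : ι → V) :
    semiIP Z v (∑ i ∈ t, w i) = ∑ i ∈ t, semiIP Z v (w i) := by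
  simp only [semiIP, inner_sum, map_sum, Finset.sum_sub_distrib, Finset.sum_neg_distrib]

lemma semiIP_self (Z : V →L[ℝ] V) (v : V) : semiIP Z v v = -2 * ⟪Z v, v⟫ := by
  simp only [semiIP, real_inner_comm (Z v) v]; ring

lemma semiIP_self_nonneg (hZ : ∀ v : V, ⟪Z v, v⟫ ≤ 0) (v : V) : 0 ≤ semiIP Z v v := by
  rw [semiIP_self]; linarith [hZ v]

lemma semiIP_add_self (Z : V →L[ℝ] V) (v w : V) :
    semiIP Z (v + w) (v + w) = semiIP Z v v + 2 * semiIP Z v w + semiIP Z w w := by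
  rw [semiIP_add_right, semiIP_comm Z _ v, semiIP_comm Z _ w, semiIP_add_right, semiIP_add_right,
    semiIP_comm Z w v]
  ring

lemma semiIP_sum_smul_self {ι : Type*} (Z : V →L[ℝ] V) (t : Finset ι) (x : ι → ℝ) (v : ι → V) :
    semiIP Z (∑ i ∈ t, x i • v i) (∑ i ∈ t, x i • v i)
      = ∑ i ∈ t, ∑ j ∈ t, x i * (x j * semiIP Z (v i) (v j)) := by
  rw [semiIP_sum_right, Finset.sum_comm]
  refine Finset.sum_congr rfl fun j _ ↦ ?_
  rw [semiIP_smul_right, semiIP_comm, semiIP_sum_right, Finset.mul_sum]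
  refine Finset.sum_congr rfl fun i _ ↦ ?_
  rw [semiIP_smul_right, semiIP_comm]; ring

lemma abs_semiIP_le_norm (Z : V →L[ℝ] V) (v w : V) : |semiIP Z v w| ≤ 2 * ‖Z‖ * ‖v‖ * ‖w‖ := by
  have h₁ : |⟪Z v, w⟫| ≤ ‖Z‖ * ‖v‖ * ‖w‖ :=
    (abs_real_inner_le_norm _ _).trans (by gcongr; exact Z.le_opNorm v)
  have h₂ : |⟪v, Z w⟫| ≤ ‖v‖ * (‖Z‖ * ‖w‖) :=
    (abs_real_inner_le_norm _ _).trans (by gcongr; exact Z.le_opNorm w)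
  rw [abs_le] at *
  constructor <;> simp only [semiIP] <;> linarith

lemma two_mul_abs_semiIP_le (hZ : ∀ v : V, ⟪Z v, v⟫ ≤ 0) {η : ℝ} (hη : 0 < η) (v w : V) :
    2 * |semiIP Z v w| ≤ η * semiIP Z v v + η⁻¹ * semiIP Z w w := by
  have key (c : ℝ) :
      0 ≤ semiIP Z v v + 2 * (c * semiIP Z v w) + c * (c * semiIP Z w w) := by
    have h := semiIP_self_nonneg hZ (v + c • w)
    rwa [semiIP_add_self, semiIP_smul_right, semiIP_smul_right, semiIP_comm Z (c • w),
      semiIP_smul_right] at h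
  have h (c : ℝ) := mul_nonneg hη.le (key c)
  have h₁ := h η⁻¹
  have h₂ := h (-η⁻¹)
  have e : η * η⁻¹ = 1 := mul_inv_cancel₀ hη.ne'
  rw [← abs_two, ← abs_mul, abs_le]
  constructor
  · linear_combination h₁ + (2 * semiIP Z v w + η⁻¹ * semiIP Z w w) * e
  · linear_combination h₂ + (-2 * semiIP Z v w + η⁻¹ * semiIP Z w w) * e

lemma posSemidef_gram_semiIP {n : Type*} [Fintype n] (hZ : ∀ v : V, ⟪Z v, v⟫ ≤ 0) (v : n → V) :
    (Matrix.of fun i j ↦ semiIP Z (v i) (v j)).PosSemidef := by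
  refine .of_dotProduct_mulVec_nonneg ?_ fun x ↦ ?_
  · ext i j
    simp [semiIP_comm Z (v j)]
  · have h := semiIP_self_nonneg hZ (∑ i, x i • v i)
    rw [semiIP_sum_smul_self] at h
    simpa [dotProduct, Matrix.mulVec, Finset.mul_sum, mul_comm, mul_left_comm] using h

/-- The Schur product of a positive semidefinite matrix with a Gram matrix of the semi-inner
product has nonnegative entry sum. -/
lemma Matrix.PosSemidef.sum_mul_semiIP_nonneg {n : Type*} [Fintype n] {M : Matrix n n ℝ}
    (hM : M.PosSemidef) (hZ : ∀ v : V, ⟪Z v, v⟫ ≤ 0) (v : n → V) :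
    0 ≤ ∑ i, ∑ j, M i j * semiIP Z (v i) (v j) := by
  have h := (hM.hadamard (posSemidef_gram_semiIP hZ v)).dotProduct_mulVec_nonneg 1
  simpa [dotProduct, Matrix.mulVec] using h

end SemiInnerProduct

section Negligible

variable {V : Type*} [NormedAddCommGroup V] [InnerProductSpace ℝ V]

/-- A functional is negligible at order `k` if it is at most an arbitrarily small multiple of
`∑ i < k, [Z ^ i u, Z ^ i u]` plus `O(‖Z‖) ‖Z ^ k u‖ ^ 2`, uniformly over semi-negative `Z`
in the unit ball. -/
def IsNegligible (k : ℕ) (f : (V →L[ℝ] V) → V → ℝ) : Prop :=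
  ∀ η > 0, ∃ C, ∀ Z : V →L[ℝ] V, (∀ v : V, ⟪Z v, v⟫ ≤ 0) → ‖Z‖ ≤ 1 → ∀ u : V,
    |f Z u| ≤ η * ∑ i ∈ Finset.range k, semiIP Z ((Z ^ i) u) ((Z ^ i) u)
      + C * ‖Z‖ * ‖(Z ^ k) u‖ ^ 2

namespace IsNegligible

variable {k : ℕ} {f g : (V →L[ℝ] V) → V → ℝ}

lemma add (hf : IsNegligible k f) (hg : IsNegligible k g) :
    IsNegligible k fun Z u ↦ f Z u + g Z u := fun η hη ↦ by
  obtain ⟨C, hC⟩ := hf (η / 2) (half_pos hη)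
  obtain ⟨D, hD⟩ := hg (η / 2) (half_pos hη)
  refine ⟨C + D, fun Z hZ h1 u ↦ (abs_add_le _ _).trans ?_⟩
  linarith [hC Z hZ h1 u, hD Z hZ h1 u]

lemma const_mul (c : ℝ) (hf : IsNegligible k f) : IsNegligible k fun Z u ↦ c * f Z u :=
  fun η hη ↦ by
  have hc : 0 < |c| + 1 := by positivity
  obtain ⟨C, hC⟩ := hf (η / (|c| + 1)) (div_pos hη hc)
  refine ⟨(|c| + 1) * C, fun Z hZ h1 u ↦ ?_⟩
  calc |c * f Z u| ≤ (|c| + 1) * |f Z u| := by rw [abs_mul]; gcongr; linarith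
    _ ≤ _ := mul_le_mul_of_nonneg_left (hC Z hZ h1 u) hc.le
    _ = _ := by field_simp

lemma of_norm_le (C : ℝ) (hf : ∀ Z : V →L[ℝ] V, ‖Z‖ ≤ 1 → ∀ u : V,
    |f Z u| ≤ C * ‖Z‖ * ‖(Z ^ k) u‖ ^ 2) : IsNegligible k f :=
  fun _ hη ↦ ⟨C, fun Z hZ h1 u ↦ (hf Z h1 u).trans <| le_add_of_nonneg_left <|
    mul_nonneg hη.le <| Finset.sum_nonneg fun _ _ ↦ semiIP_self_nonneg hZ _⟩

lemma zero : IsNegligible k fun (_ : V →L[ℝ] V) _ ↦ (0 : ℝ) := of_norm_le 0 (by simp)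

lemma sum {ι : Type*} (t : Finset ι) {F : ι → (V →L[ℝ] V) → V → ℝ}
    (h : ∀ i ∈ t, IsNegligible k (F i)) : IsNegligible k fun Z u ↦ ∑ i ∈ t, F i Z u := by
  classical
  induction t using Finset.induction_on with
  | empty => simpa using zero
  | insert a t ha ih =>
    simp only [Finset.sum_insert ha]
    exact (h a (t.mem_insert_self a)).add (ih fun i hi ↦ h i (Finset.mem_insert_of_mem hi))

lemma semiIP_of_norm_le {e e' : (V →L[ℝ] V) → V → V} {C D : ℝ}
    (he : ∀ Z : V →L[ℝ] V, ‖Z‖ ≤ 1 → ∀ u : V, ‖e Z u‖ ≤ C * ‖(Z ^ k) u‖)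
    (he' : ∀ Z : V →L[ℝ] V, ‖Z‖ ≤ 1 → ∀ u : V, ‖e' Z u‖ ≤ D * ‖(Z ^ k) u‖) :
    IsNegligible k fun Z u ↦ semiIP Z (e Z u) (e' Z u) := by
  refine of_norm_le (2 * C * D) fun Z h1 u ↦ (abs_semiIP_le_norm _ _ _).trans ?_
  have h := mul_le_mul (he Z h1 u) (he' Z h1 u) (norm_nonneg _)
    ((norm_nonneg _).trans (he Z h1 u))
  linarith [mul_le_mul_of_nonneg_left h (norm_nonneg Z)]

lemma semiIP_pow {i : ℕ} (hi : i < k) {e : (V →L[ℝ] V) → V → V} {C : ℝ}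
    (he : ∀ Z : V →L[ℝ] V, ‖Z‖ ≤ 1 → ∀ u : V, ‖e Z u‖ ≤ C * ‖(Z ^ k) u‖) :
    IsNegligible k fun Z u ↦ semiIP Z ((Z ^ i) u) (e Z u) := fun η hη ↦ by
  obtain ⟨D, hD⟩ := semiIP_of_norm_le he he (η ^ 2) (by positivity)
  refine ⟨η⁻¹ * D / 2, fun Z hZ h1 u ↦ ?_⟩
  have hy := two_mul_abs_semiIP_le hZ hη ((Z ^ i) u) (e Z u)
  have hs : semiIP Z ((Z ^ i) u) ((Z ^ i) u)
      ≤ ∑ i ∈ Finset.range k, semiIP Z ((Z ^ i) u) ((Z ^ i) u) :=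
    Finset.single_le_sum (f := fun i ↦ semiIP Z ((Z ^ i) u) ((Z ^ i) u))
      (fun _ _ ↦ semiIP_self_nonneg hZ _) (Finset.mem_range.2 hi)
  have hq := mul_le_mul_of_nonneg_left ((le_abs_self _).trans (hD Z hZ h1 u)) (inv_pos.2 hη).le
  rw [mul_add, ← mul_assoc, pow_two, inv_mul_cancel_left₀ hη.ne'] at hq
  linarith [mul_le_mul_of_nonneg_left hs hη.le]

end IsNegligible

end Negligible

section Operators

variable {V : Type*} [NormedAddCommGroup V] [InnerProductSpace ℝ V] {Z : V →L[ℝ] V}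

lemma norm_pow_apply_le_of_le (hZ : ‖Z‖ ≤ 1) {k j : ℕ} (hkj : k ≤ j) (u : V) :
    ‖(Z ^ j) u‖ ≤ ‖(Z ^ k) u‖ := by
  induction j, hkj using Nat.le_induction with
  | base => rfl
  | succ j _ ih =>
    rw [pow_succ', mul_apply_eq_comp]
    exact ((Z.le_of_opNorm_le hZ _).trans_eq (one_mul _)).trans ih

lemma norm_pow_apply_le_of_lt (hZ : ‖Z‖ ≤ 1) {k j : ℕ} (hkj : k < j) (u : V) :
    ‖(Z ^ j) u‖ ≤ ‖Z‖ * ‖(Z ^ k) u‖ := by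
  refine (norm_pow_apply_le_of_le hZ hkj u).trans ?_
  rw [pow_succ', mul_apply_eq_comp]
  exact Z.le_opNorm _

/-- The part of `Z ^ m (R(Z) u)` of degree greater than `m` in `Z`. -/
noncomputable def rkTail (α : ℕ → ℝ) (s m : ℕ) (Z : V →L[ℝ] V) (u : V) : V :=
  ∑ j ∈ Finset.range s, α (j + 1) • (Z ^ (m + 1 + j)) u

lemma pow_apply_sum_smul_pow {α : ℕ → ℝ} (hα : α 0 = 1) (s m : ℕ) (Z : V →L[ℝ] V) (u : V) :
    (Z ^ m) ((∑ j ∈ Finset.range (s + 1), α j • Z ^ j) u) = (Z ^ m) u + rkTail α s m Z u := by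
  rw [← mul_apply_eq_comp, Finset.sum_range_succ', mul_add]
  simp only [rkTail, Finset.mul_sum, hα, pow_zero, one_smul, mul_one, mul_smul_comm, ← pow_add,
    add_apply, sum_apply, smul_apply]
  rw [add_comm]
  simp only [add_assoc, add_comm 1]

lemma norm_rkTail_le (α : ℕ → ℝ) (s m : ℕ) (hZ : ‖Z‖ ≤ 1) (u : V) :
    ‖rkTail α s m Z u‖ ≤ (∑ j ∈ Finset.range s, |α (j + 1)|) * ‖(Z ^ (m + 1)) u‖ := by
  rw [Finset.sum_mul]
  refine norm_sum_le_of_le _ fun j _ ↦ ?_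
  rw [norm_smul, Real.norm_eq_abs]
  gcongr
  exact norm_pow_apply_le_of_le hZ (Nat.le_add_right _ _) u

variable [CompleteSpace V]

lemma norm_adjoint_pow_apply_le (hZ : ‖Z‖ ≤ 1) {m : ℕ} (hm : 1 ≤ m) (v : V) :
    ‖(adjoint Z ^ m) v‖ ≤ ‖Z‖ * ‖v‖ := by
  have h : ‖adjoint Z‖ = ‖Z‖ := LinearIsometryEquiv.norm_map _ _
  simpa [h] using norm_pow_apply_le_of_lt (Z := adjoint Z) (h.trans_le hZ) hm v

lemma inner_adjoint_pow_mul_apply (Z : V →L[ℝ] V) (m n : ℕ) (w : V) :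
    ⟪w, (adjoint Z ^ m * Z ^ n) w⟫ = ⟪(Z ^ m) w, (Z ^ n) w⟫ := by
  rw [mul_apply_eq_comp, ← ContinuousLinearMap.star_eq_adjoint, ← star_pow,
    ContinuousLinearMap.star_eq_adjoint, ContinuousLinearMap.adjoint_inner_right]

lemma norm_filter_apply_sq (Z : V →L[ℝ] V) (m : ℕ) (μ ν : ℝ) (w : V) :
    ‖(1 + μ • (adjoint Z ^ m * Z ^ (m + 1)) + ν • (adjoint Z ^ (m + 1) * Z ^ (m + 1))) w‖ ^ 2
      = ‖w‖ ^ 2 - μ * semiIP Z ((Z ^ m) w) ((Z ^ m) w) + 2 * ν * ‖(Z ^ (m + 1)) w‖ ^ 2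
        + ‖(μ • (adjoint Z ^ m * Z ^ (m + 1)) + ν • (adjoint Z ^ (m + 1) * Z ^ (m + 1))) w‖ ^ 2 := by
  have h : ⟪w, (μ • (adjoint Z ^ m * Z ^ (m + 1))
      + ν • (adjoint Z ^ (m + 1) * Z ^ (m + 1))) w⟫
      = μ * ⟪Z ((Z ^ m) w), (Z ^ m) w⟫ + ν * ‖(Z ^ (m + 1)) w‖ ^ 2 := by
    rw [add_apply, smul_apply,
      smul_apply, inner_add_right, inner_smul_right, inner_smul_right,
      inner_adjoint_pow_mul_apply, inner_adjoint_pow_mul_apply, real_inner_self_eq_norm_sq,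
      real_inner_comm, pow_succ' Z m, mul_apply_eq_comp]
  rw [add_assoc, add_apply, one_apply_eq_self, norm_add_sq_real, h,
    semiIP_self]
  ring

lemma norm_superviscosity_apply_le (hZ : ‖Z‖ ≤ 1) {m : ℕ} (hm : 1 ≤ m) (μ ν : ℝ) (w : V) :
    ‖(μ • (adjoint Z ^ m * Z ^ (m + 1)) + ν • (adjoint Z ^ (m + 1) * Z ^ (m + 1))) w‖
      ≤ (|μ| + |ν|) * (‖Z‖ * ‖(Z ^ (m + 1)) w‖) := by
  rw [add_mul, add_apply]
  refine norm_add_le_of_le ?_ ?_ <;>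
  · rw [smul_apply, norm_smul, Real.norm_eq_abs, mul_apply_eq_comp]
    gcongr
    exact norm_adjoint_pow_apply_le hZ (by lia) _

end Operators

section Remainder

variable {V : Type*} [NormedAddCommGroup V] [InnerProductSpace ℝ V]

lemma isNegligible_sum_Ioc (k s : ℕ) (β : ℕ → ℝ) :
    IsNegligible k fun (Z : V →L[ℝ] V) u ↦ ∑ l ∈ Finset.Ioc k s, β l * ‖(Z ^ l) u‖ ^ 2 := by
  refine .sum _ fun l hl ↦ .const_mul _ <| .of_norm_le 1 fun Z hZ u ↦ ?_
  have h := norm_pow_apply_le_of_lt hZ (Finset.mem_Ioc.1 hl).1 u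
  have h' := norm_pow_apply_le_of_le hZ (Finset.mem_Ioc.1 hl).1.le u
  rw [abs_of_nonneg (by positivity)]
  linarith [mul_le_mul h h' (norm_nonneg _) (by positivity)]

lemma isNegligible_sum_semiIP (k s : ℕ) (γ : ℕ → ℕ → ℝ) :
    IsNegligible k fun (Z : V →L[ℝ] V) u ↦ ∑ i ∈ Finset.range s, ∑ j ∈ Finset.range s,
      (if i < k ∧ j < k then 0 else γ i j) * semiIP Z ((Z ^ i) u) ((Z ^ j) u) := by
  have hpow {j : ℕ} (hj : k ≤ j) (Z : V →L[ℝ] V) (hZ : ‖Z‖ ≤ 1) (u : V) :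
      ‖(Z ^ j) u‖ ≤ 1 * ‖(Z ^ k) u‖ := by
    rw [one_mul]; exact norm_pow_apply_le_of_le hZ hj u
  refine .sum _ fun i _ ↦ .sum _ fun j _ ↦ ?_
  by_cases hi : i < k
  · by_cases hj : j < k
    · simpa [hi, hj] using IsNegligible.zero
    · exact .const_mul _ (.semiIP_pow hi (hpow (not_lt.1 hj)))
  · refine .const_mul _ ?_
    by_cases hj : j < k
    · simpa only [semiIP_comm] using IsNegligible.semiIP_pow hj (hpow (not_lt.1 hi))
    · exact .semiIP_of_norm_le (hpow (not_lt.1 hi)) (hpow (not_lt.1 hj))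

lemma isNegligible_semiIP_rkTail (α : ℕ → ℝ) (s m : ℕ) :
    IsNegligible (m + 1) fun (Z : V →L[ℝ] V) u ↦
      2 * semiIP Z ((Z ^ m) u) (rkTail α s m Z u)
        + semiIP Z (rkTail α s m Z u) (rkTail α s m Z u) :=
  have h (Z : V →L[ℝ] V) (hZ : ‖Z‖ ≤ 1) (u : V) := norm_rkTail_le α s m hZ u
  .add (.const_mul _ (.semiIP_pow m.lt_succ_self h)) (.semiIP_of_norm_le h h)

lemma isNegligible_inner_rkTail (α : ℕ → ℝ) (s k : ℕ) :
    IsNegligible k fun (Z : V →L[ℝ] V) u ↦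
      2 * ⟪(Z ^ k) u, rkTail α s k Z u⟫ + ‖rkTail α s k Z u‖ ^ 2 := by
  set A := ∑ j ∈ Finset.range s, |α (j + 1)|
  have hA : 0 ≤ A := Finset.sum_nonneg fun _ _ ↦ abs_nonneg _
  refine .of_norm_le (2 * A + A ^ 2) fun Z hZ u ↦ ?_
  have h : ‖rkTail α s k Z u‖ ≤ A * (‖Z‖ * ‖(Z ^ k) u‖) :=
    (norm_rkTail_le α s k hZ u).trans
      (mul_le_mul_of_nonneg_left (norm_pow_apply_le_of_lt hZ k.lt_succ_self u) hA)
  calc _ ≤ 2 * (‖(Z ^ k) u‖ * ‖rkTail α s k Z u‖) + ‖rkTail α s k Z u‖ ^ 2 := by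
        refine (abs_add_le _ _).trans ?_
        rw [abs_mul, abs_two, abs_of_nonneg (sq_nonneg ‖rkTail α s k Z u‖)]
        gcongr
        exact abs_real_inner_le_norm _ _
    _ ≤ 2 * (‖(Z ^ k) u‖ * (A * (‖Z‖ * ‖(Z ^ k) u‖))) + (A * (‖Z‖ * ‖(Z ^ k) u‖)) ^ 2 := by
        gcongr
    _ = 2 * A * ‖Z‖ * ‖(Z ^ k) u‖ ^ 2 + A ^ 2 * (‖Z‖ * ‖Z‖) * ‖(Z ^ k) u‖ ^ 2 := by ring
    _ ≤ 2 * A * ‖Z‖ * ‖(Z ^ k) u‖ ^ 2 + A ^ 2 * (‖Z‖ * 1) * ‖(Z ^ k) u‖ ^ 2 := by gcongr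
    _ = _ := by ring

lemma isNegligible_superviscosity_sq [CompleteSpace V] {α : ℕ → ℝ} (hα : α 0 = 1) (s : ℕ) {m : ℕ}
    (hm : 1 ≤ m) (μ ν : ℝ) :
    IsNegligible (m + 1) fun (Z : V →L[ℝ] V) u ↦
      ‖(μ • (adjoint Z ^ m * Z ^ (m + 1)) + ν • (adjoint Z ^ (m + 1) * Z ^ (m + 1)))
        ((∑ j ∈ Finset.range (s + 1), α j • Z ^ j) u)‖ ^ 2 := by
  set A := ∑ j ∈ Finset.range s, |α (j + 1)|
  have hA : 0 ≤ A := Finset.sum_nonneg fun _ _ ↦ abs_nonneg _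
  refine .of_norm_le ((|μ| + |ν|) ^ 2 * (1 + A) ^ 2) fun Z hZ u ↦ ?_
  have h : ‖(Z ^ (m + 1)) ((∑ j ∈ Finset.range (s + 1), α j • Z ^ j) u)‖
      ≤ (1 + A) * ‖(Z ^ (m + 1)) u‖ := by
    rw [pow_apply_sum_smul_pow hα, add_mul, one_mul]
    refine norm_add_le_of_le le_rfl ((norm_rkTail_le α s _ hZ u).trans ?_)
    gcongr
    exact norm_pow_apply_le_of_le hZ (Nat.le_succ _) u
  rw [abs_of_nonneg (by positivity)]
  calc _ ≤ ((|μ| + |ν|) * (‖Z‖ * ((1 + A) * ‖(Z ^ (m + 1)) u‖))) ^ 2 := by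
        gcongr
        exact (norm_superviscosity_apply_le hZ hm μ ν _).trans (by gcongr)
    _ = (|μ| + |ν|) ^ 2 * (1 + A) ^ 2 * (‖Z‖ * ‖Z‖) * ‖(Z ^ (m + 1)) u‖ ^ 2 := by ring
    _ ≤ (|μ| + |ν|) ^ 2 * (1 + A) ^ 2 * (‖Z‖ * 1) * ‖(Z ^ (m + 1)) u‖ ^ 2 := by gcongr
    _ = _ := by ring

lemma exists_sum_semiIP_le {m : ℕ} {γ : ℕ → ℕ → ℝ} {μ : ℝ}
    (h : (-(Matrix.of (fun i j : Fin (m + 1) ↦ γ i j)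
      - Matrix.diagonal (fun i : Fin (m + 1) ↦ if (i : ℕ) = m then μ else 0))).PosDef) :
    ∃ ε : ℝ, 0 < ε ∧ ∀ Z : V →L[ℝ] V, (∀ v : V, ⟪Z v, v⟫ ≤ 0) → ∀ v : ℕ → V,
      ∑ i ∈ Finset.range (m + 1), ∑ j ∈ Finset.range (m + 1), γ i j * semiIP Z (v i) (v j)
        - μ * semiIP Z (v m) (v m)
        ≤ -ε * ∑ i ∈ Finset.range (m + 1), semiIP Z (v i) (v i) := by
  obtain ⟨ε, hε, hM⟩ := h.exists_pos_sub_smul_one_posSemidef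
  refine ⟨ε, hε, fun Z hZ v ↦ ?_⟩
  have h := hM.sum_mul_semiIP_nonneg hZ fun i ↦ v i
  have hμ : ∑ i : Fin (m + 1), (if (i : ℕ) = m then μ else 0) * semiIP Z (v i) (v i)
      = μ * semiIP Z (v m) (v m) := by
    rw [Finset.sum_eq_single (Fin.last m)] <;> simp +contextual [Fin.ext_iff]
  simp only [Matrix.sub_apply, Matrix.of_apply, Matrix.smul_apply,
    Matrix.diagonal_apply, Matrix.one_apply, smul_eq_mul, sub_mul, neg_sub, mul_ite,
    mul_one, mul_zero, ite_mul, zero_mul, Finset.sum_sub_distrib, Finset.sum_ite_eq,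
    Finset.mem_univ, if_true, ← Finset.mul_sum] at h hμ
  simp only [Finset.sum_range]
  linarith

end Remainder

/-- strong stability of the filtering method with dispersive-diffusive
superviscosity `μ > μ₀`, `ν < −β_{k*}/2`. -/
theorem filtering_dispersive_diffusive_strongly_stable
    {V : Type*} [NormedAddCommGroup V] [InnerProductSpace ℝ V] [CompleteSpace V]
    (s : ℕ) (hs : 1 ≤ s) (α : ℕ → ℝ) (hα0 : α 0 = 1) (hα1 : α 1 = 1)
    (kst : ℕ) (hk1 : 2 ≤ kst) (hks : kst ≤ s)
    (β : ℕ → ℝ) (γ : ℕ → ℕ → ℝ) (hsym : ∀ i j, γ i j = γ j i)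
    (hidentity : ∀ Z : V →L[ℝ] V, (∀ v : V, ⟪Z v, v⟫ ≤ 0) → ∀ u0 : V,
      ‖(∑ j ∈ Finset.range (s + 1), α j • Z ^ j) u0‖ ^ 2 - ‖u0‖ ^ 2
        = ∑ k ∈ Finset.Icc kst s, β k * ‖(Z ^ k) u0‖ ^ 2
          + ∑ i ∈ Finset.range s, ∑ j ∈ Finset.range s,
              γ i j * semiIP Z ((Z ^ i) u0) ((Z ^ j) u0))
    (μ₀ : ℝ)
    (hmat : ∀ μ' : ℝ, μ₀ < μ' →
      (-(Matrix.of (fun i j : Fin kst => γ i j)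
          - Matrix.diagonal (fun i : Fin kst => if (i : ℕ) = kst - 1 then μ' else 0))).PosDef)
    (μ ν : ℝ) (hμ : μ₀ < μ) (hν : ν < -β kst / 2) :
    ∃ lam0 : ℝ, 0 < lam0 ∧
      ∀ Z : V →L[ℝ] V, (∀ v : V, ⟪Z v, v⟫ ≤ 0) → ‖Z‖ ≤ lam0 → ∀ u0 : V,
        ‖((1 : V →L[ℝ] V) + μ • (adjoint Z ^ (kst - 1) * Z ^ kst)
            + ν • (adjoint Z ^ kst * Z ^ kst))
            ((∑ j ∈ Finset.range (s + 1), α j • Z ^ j) u0)‖ ≤ ‖u0‖ := by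
  obtain ⟨m, rfl⟩ : ∃ m, kst = m + 1 := ⟨kst - 1, by lia⟩
  simp only [Nat.add_sub_cancel] at hmat ⊢
  obtain ⟨ε, hε, hΓ⟩ := exists_sum_semiIP_le (V := V) (hmat μ hμ)
  obtain ⟨C, hC⟩ := ((((isNegligible_sum_Ioc (V := V) (m + 1) s β).add
    (isNegligible_sum_semiIP (m + 1) s γ)).add
    ((isNegligible_semiIP_rkTail α s m).const_mul (-μ))).add
    ((isNegligible_inner_rkTail α s (m + 1)).const_mul (2 * ν))).add
    (isNegligible_superviscosity_sq hα0 s (by lia : 1 ≤ m) μ ν) ε hε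
  have hδ : 0 < -(β (m + 1) + 2 * ν) := by linarith
  have hC1 : 0 < |C| + 1 := by positivity
  refine ⟨min 1 (-(β (m + 1) + 2 * ν) / (|C| + 1)), lt_min one_pos (div_pos hδ hC1),
    fun Z hZ hZle u ↦ (sq_le_sq₀ (norm_nonneg _) (norm_nonneg _)).1 ?_⟩
  have hZ1 := hZle.trans (min_le_left _ _)
  have hCZ : C * ‖Z‖ ≤ -(β (m + 1) + 2 * ν) := calc
    C * ‖Z‖ ≤ (|C| + 1) * ‖Z‖ := by gcongr; linarith [le_abs_self C]
    _ ≤ _ := by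
      rw [mul_comm, ← le_div_iff₀ hC1]
      exact hZle.trans (min_le_right _ _)
  have hγ : ∑ i ∈ Finset.range s, ∑ j ∈ Finset.range s,
        γ i j * semiIP Z ((Z ^ i) u) ((Z ^ j) u)
      = ∑ i ∈ Finset.range (m + 1), ∑ j ∈ Finset.range (m + 1),
          γ i j * semiIP Z ((Z ^ i) u) ((Z ^ j) u)
        + ∑ i ∈ Finset.range s, ∑ j ∈ Finset.range s,
          (if i < m + 1 ∧ j < m + 1 then 0 else γ i j) * semiIP Z ((Z ^ i) u) ((Z ^ j) u) := by
    have hr : {i ∈ Finset.range s | i < m + 1} = Finset.range (m + 1) := by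
      ext i; simp only [Finset.mem_filter, Finset.mem_range]; lia
    simp only [← hr, Finset.sum_filter, ← Finset.sum_add_distrib]
    refine Finset.sum_congr rfl fun i _ ↦ ?_
    by_cases hi : i < m + 1
    · simp only [hi, true_and, if_true, ← Finset.sum_add_distrib]
      exact Finset.sum_congr rfl fun j _ ↦ by split_ifs <;> simp
    · simp [hi]
  have hid := hidentity Z hZ u
  rw [hγ, ← Finset.add_sum_Ioc_eq_sum_Icc hks] at hid
  have hrem := (le_abs_self _).trans (hC Z hZ hZ1 u)
  have hquad := hΓ Z hZ fun i ↦ (Z ^ i) u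
  have hdiss := mul_le_mul_of_nonneg_right hCZ (sq_nonneg ‖(Z ^ (m + 1)) u‖)
  rw [norm_filter_apply_sq, pow_apply_sum_smul_pow hα0, pow_apply_sum_smul_pow hα0,
    semiIP_add_self, norm_add_sq_real]
  linarith
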